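/- Let γ(t) = Ψ(u(t), v(t)) be a nondegenerate curve in S₁² with principal normal n(t), and let Z = (0,0,1). Then ⟨n(t), Z⟩ = − v'(t) cosh(u(t))² / |γ'(t)| for all t. -/

import Mathlib

noncomputable section

open Real

/-- Lorentzian inner product on `ℝ³`: `⟨p,q⟩ = p₁q₁ + p₂q₂ − p₃q₃`. -/
def lprod (p q : Fin 3 → ℝ) : ℝ := p 0 * q 0 + p 1 * q 1 - p 2 * q 2

/-- Determinant of the 3×3 matrix with rows `a`, `b`, `c`. -/
def det3 (a b c : Fin 3 → ℝ) : ℝ :=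
  a 0 * (b 1 * c 2 - b 2 * c 1) - a 1 * (b 0 * c 2 - b 2 * c 0)
    + a 2 * (b 0 * c 1 - b 1 * c 0)

/-- Parametrization `Ψ` of the de Sitter plane `S₁² ⊂ L³`. -/
def Psi (u v : ℝ) : Fin 3 → ℝ :=
  ![Real.cosh u * Real.cos v, Real.cosh u * Real.sin v, Real.sinh u]

/-- Lorentzian cross product, characterized by `lprod (lcross a b) c = det3 a b c`. -/
def lcross (a b : Fin 3 → ℝ) : Fin 3 → ℝ :=
  ![a 1 * b 2 - a 2 * b 1, a 2 * b 0 - a 0 * b 2, a 1 * b 0 - a 0 * b 1]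

lemma hasDerivAt_Psi {u v : ℝ → ℝ} {u' v' t : ℝ} (hu : HasDerivAt u u' t)
    (hv : HasDerivAt v v' t) :
    HasDerivAt (fun s => Psi (u s) (v s))
      ![Real.sinh (u t) * u' * Real.cos (v t) + Real.cosh (u t) * (-Real.sin (v t) * v'),
        Real.sinh (u t) * u' * Real.sin (v t) + Real.cosh (u t) * (Real.cos (v t) * v'),
        Real.cosh (u t) * u'] t := by
  rw [hasDerivAt_pi]
  intro i
  fin_cases i
  · exact hu.cosh.mul hv.cos
  · exact hu.cosh.mul hv.sin
  · exact hu.sinh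

theorem normal_inner_Z
    (u v : ℝ → ℝ) (hu : ContDiff ℝ (⊤ : ℕ∞) u) (hv : ContDiff ℝ (⊤ : ℕ∞) v)
    (ε : ℝ) (hε : ε = 1 ∨ ε = -1)
    (γ : ℝ → Fin 3 → ℝ) (hγ : ∀ t, γ t = Psi (u t) (v t))
    (sp : ℝ → ℝ)
    (hsp : ∀ t, sp t =
      Real.sqrt (ε * ((deriv v t) ^ 2 * Real.cosh (u t) ^ 2 - (deriv u t) ^ 2)))
    (hnd : ∀ t, 0 < ε * ((deriv v t) ^ 2 * Real.cosh (u t) ^ 2 - (deriv u t) ^ 2))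
    (n : ℝ → Fin 3 → ℝ) (hn : ∀ t, n t = (-(1 / sp t)) • lcross (γ t) (deriv γ t))
    :
    ∀ t, lprod (n t) ![(0 : ℝ), 0, 1] = -(deriv v t * Real.cosh (u t) ^ 2) / sp t := by
  intro t
  have hut : HasDerivAt u (deriv u t) t :=
    (hu.differentiable (by simp) t).hasDerivAt
  have hvt : HasDerivAt v (deriv v t) t :=
    (hv.differentiable (by simp) t).hasDerivAt
  have hγ' := (hasDerivAt_Psi hut hvt).deriv
  rw [← funext hγ] at hγ'
  rw [hn, hγ', hγ]
  simp only [lprod, lcross, Psi, Pi.smul_apply, smul_eq_mul, Matrix.cons_val]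
  linear_combination
    (-(deriv v t * Real.cosh (u t) ^ 2) / sp t) * Real.sin_sq_add_cos_sq (v t)
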